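/- Let F : {0,1}^n → ℝ≥0. If F is not in the functional clone ⟨NEQ, ℬ₁⟩, then IMP ∈ ⟨F, ℬ₁⟩_ω, and hence ⟨IMP, ℬ₁⟩_ω ⊆ ⟨F, ℬ₁⟩_ω. If, in addition, F is not log-supermodular, then ⟨F, ℬ₁⟩_ω = ℬ, the set of all nonnegative-real-valued functions on {0,1}^k for all k. -/

import Mathlib

open scoped NNReal BigOperators

/-- Functions of arity `n` on the Boolean domain with values in `R`. -/
abbrev FnOn (R : Type) (n : ℕ) : Type := (Fin n → Bool) → R

/-- Functions of all arities on the Boolean domain with values in `R`. -/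
abbrev Fn (R : Type) : Type := Σ n : ℕ, FnOn R n

/-- The binary equality function: `EQ(x,x) = 1`, `EQ(x,y) = 0` for `x ≠ y`. -/
def EQfn (R : Type) [CommSemiring R] : Fn R :=
  ⟨2, fun x => if x 0 = x 1 then 1 else 0⟩

/-- `F` (of arity `n`) is representable by a pps-formula over `𝓕`: there are `m` bound
variables and `s` atomic formulas, the `j`-th atomic formula applying `G j ∈ 𝓕` to a
scope `σ j` of (possibly repeated) variables among the `n + m` variables; `F x` is the
sum over all Boolean assignments of the bound variables of the product of the values of
the atomic formulas. -/
def PpsRep (R : Type) [CommSemiring R] (𝓕 : Set (Fn R)) {n : ℕ} (F : FnOn R n) : Prop :=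
  ∃ (m s : ℕ) (G : Fin s → Fn R) (σ : (j : Fin s) → Fin (G j).1 → Fin (n + m)),
    (∀ j, G j ∈ 𝓕) ∧
    ∀ x : Fin n → Bool,
      F x = ∑ y : Fin m → Bool, ∏ j : Fin s, (G j).2 (fun i => Fin.append x y (σ j i))

/-- The functional clone `⟨𝓕⟩` generated by `𝓕`: all functions representable by a
pps-formula over `𝓕 ∪ {EQ}`. -/
def Clone (R : Type) [CommSemiring R] (𝓕 : Set (Fn R)) : Set (Fn R) :=
  {F | PpsRep R (𝓕 ∪ {EQfn R}) F.2}

/-- The pps_ω-definable functional clone `⟨𝓕⟩_ω`: all functions `F` such that for some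
finite `S ⊆ 𝓕 ∪ {EQ}` and every `ε > 0`, some function of the same arity representable
by a pps-formula over `S` is within `ε` of `F` in the sup norm. -/
def CloneOmega (R : Type) [CommSemiring R] [MetricSpace R] (𝓕 : Set (Fn R)) :
    Set (Fn R) :=
  {F | ∃ S : Set (Fn R), S ⊆ 𝓕 ∪ {EQfn R} ∧ S.Finite ∧
    ∀ ε : ℝ, 0 < ε → ∃ Fhat : FnOn R F.1, PpsRep R S Fhat ∧
      ∀ x : Fin F.1 → Bool, dist (Fhat x) (F.2 x) < ε}

/-- A nonnegative function on `{0,1}^n` is log-supermodular (lsm) if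
`F(x ∨ y) · F(x ∧ y) ≥ F(x) · F(y)` for all `x, y`, with `∨, ∧` componentwise. -/
def IsLSM {n : ℕ} (F : FnOn ℝ≥0 n) : Prop :=
  ∀ x y : Fin n → Bool, F x * F y ≤ F (x ⊔ y) * F (x ⊓ y)

/-- `IMP(x,y) = 0` if `(x,y) = (1,0)`, and `1` otherwise. -/
def IMPfn : Fn ℝ≥0 := ⟨2, fun x => if x 0 = true ∧ x 1 = false then 0 else 1⟩

/-- `NEQ(x,y) = 1` iff `x ≠ y`, else `0`. -/
def NEQfn : Fn ℝ≥0 := ⟨2, fun x => if x 0 ≠ x 1 then 1 else 0⟩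

/-- `OR(x,y) = 0` if `(x,y) = (0,0)`, and `1` otherwise. -/
def ORfn : Fn ℝ≥0 := ⟨2, fun x => if x 0 = false ∧ x 1 = false then 0 else 1⟩

/-- `ℬ₁`: the set of all unary functions `{0,1} → ℝ≥0`. -/
def unaryFns : Set (Fn ℝ≥0) := {F | F.1 = 1}

section PpsRep

variable {R : Type} [CommSemiring R] {S : Set (Fn R)} {n : ℕ}

theorem ppsRep_iff_exists_fintype {F : FnOn R n} :
    PpsRep R S F ↔ ∃ (ι κ : Type) (_ : Fintype ι) (_ : DecidableEq ι) (_ : Fintype κ)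
      (G : κ → Fn R) (σ : (j : κ) → Fin (G j).1 → Fin n ⊕ ι), (∀ j, G j ∈ S) ∧
      ∀ x, F x = ∑ y : ι → Bool, ∏ j, (G j).2 (fun i => Sum.elim x y (σ j i)) := by
  constructor
  · rintro ⟨m, s, G, σ, hG, hF⟩
    refine ⟨Fin m, Fin s, inferInstance, inferInstance, inferInstance, G,
      fun j i => finSumFinEquiv.symm (σ j i), hG, fun x => ?_⟩
    rw [hF]
    refine Finset.sum_congr rfl fun y _ => Finset.prod_congr rfl fun j _ => congrArg _ ?_
    funext i
    beta_reduce
    generalize σ j i = k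
    refine Fin.addCases (fun a => ?_) (fun a => ?_) k <;> simp
  · rintro ⟨ι, κ, _, _, _, G, σ, hG, hF⟩
    let e := Fintype.equivFin ι
    let f := Fintype.equivFin κ
    refine ⟨Fintype.card ι, Fintype.card κ, fun j => G (f.symm j),
      fun j i => Sum.elim (Fin.castAdd _) (fun a => Fin.natAdd n (e a)) (σ (f.symm j) i),
      fun j => hG _, fun x => ?_⟩
    rw [hF, ← (e.arrowCongr (Equiv.refl Bool)).sum_comp]
    refine Finset.sum_congr rfl fun y _ => ?_
    rw [← f.symm.prod_comp]
    refine Finset.prod_congr rfl fun j _ => congrArg _ ?_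
    funext i
    beta_reduce
    cases σ (f.symm j) i <;> simp [Equiv.arrowCongr]

theorem PpsRep.mono {S' : Set (Fn R)} (h : S ⊆ S') {F : FnOn R n} (hF : PpsRep R S F) :
    PpsRep R S' F := by
  obtain ⟨m, s, G, σ, hG, hF⟩ := hF
  exact ⟨m, s, G, σ, fun j => h (hG j), hF⟩

end PpsRep

/-- A family of sets of functions of every arity that contains the constants `1` and is closed
under products, substitution of variables and summation over variables. -/
structure IsFnClone (K : ∀ n, Set (FnOn ℝ≥0 n)) : Prop where
  one : ∀ n, (fun _ => 1) ∈ K n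
  mul : ∀ {n} {F G : FnOn ℝ≥0 n}, F ∈ K n → G ∈ K n → (fun x => F x * G x) ∈ K n
  comp : ∀ {n m} {F : FnOn ℝ≥0 n} (σ : Fin n → Fin m), F ∈ K n → (fun x => F (x ∘ σ)) ∈ K m
  sum : ∀ {n m} {F : FnOn ℝ≥0 (n + m)}, F ∈ K (n + m) →
    (fun x => ∑ y : Fin m → Bool, F (Fin.append x y)) ∈ K n

/-- The functions of arity `n` that are representable over `S`. -/
def ppsSet (S : Set (Fn ℝ≥0)) (n : ℕ) : Set (FnOn ℝ≥0 n) := {F | PpsRep ℝ≥0 S F}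

theorem isFnClone_ppsSet (S : Set (Fn ℝ≥0)) : IsFnClone (ppsSet S) where
  one n := ppsRep_iff_exists_fintype.2 ⟨Empty, Empty, inferInstance, inferInstance, inferInstance,
    fun j => j.elim, fun j => j.elim, fun j => j.elim, fun x => by simp⟩
  mul := by
    intro n F G hF hG
    obtain ⟨ι, κ, _, _, _, A, σ, hA, hF⟩ := ppsRep_iff_exists_fintype.1 hF
    obtain ⟨ι', κ', _, _, _, A', σ', hA', hG⟩ := ppsRep_iff_exists_fintype.1 hG
    refine ppsRep_iff_exists_fintype.2 ⟨ι ⊕ ι', κ ⊕ κ', inferInstance, inferInstance,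
      inferInstance, Sum.elim A A',
      fun j => match j with
        | .inl j => fun i => Sum.map id Sum.inl (σ j i)
        | .inr j => fun i => Sum.map id Sum.inr (σ' j i),
      fun j => by cases j <;> simp [hA, hA'], fun x => ?_⟩
    rw [hF, hG, Fintype.sum_mul_sum, ← Fintype.sum_prod_type',
      ← (Equiv.sumArrowEquivProdArrow ι ι' Bool).symm.sum_comp]
    refine Finset.sum_congr rfl fun y _ => ?_
    rw [Fintype.prod_sum_type]
    congr 1
    · refine Finset.prod_congr rfl fun j _ => congrArg (A j).2 ?_
      funext i
      cases h : σ j i <;> simp [h, Equiv.sumArrowEquivProdArrow]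
    · refine Finset.prod_congr rfl fun j _ => congrArg (A' j).2 ?_
      funext i
      cases h : σ' j i <;> simp [h, Equiv.sumArrowEquivProdArrow]
  comp := by
    intro n m F τ hF
    obtain ⟨ι, κ, _, _, _, A, σ, hA, hF⟩ := ppsRep_iff_exists_fintype.1 hF
    refine ppsRep_iff_exists_fintype.2 ⟨ι, κ, inferInstance, inferInstance,
      inferInstance, A, fun j i => Sum.map τ id (σ j i), hA, fun x => ?_⟩
    rw [hF]
    refine Finset.sum_congr rfl fun y _ => Finset.prod_congr rfl fun j _ => congrArg _ ?_
    funext i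
    beta_reduce
    cases σ j i <;> simp
  sum := by
    intro n m F hF
    obtain ⟨ι, κ, _, _, _, A, σ, hA, hF⟩ := ppsRep_iff_exists_fintype.1 hF
    refine ppsRep_iff_exists_fintype.2 ⟨Fin m ⊕ ι, κ, inferInstance, inferInstance,
      inferInstance, A, fun j i => Sum.elim
        (fun k => Sum.map id Sum.inl (finSumFinEquiv.symm k)) (fun k => .inr (.inr k)) (σ j i),
      hA, fun x => ?_⟩
    rw [← (Equiv.sumArrowEquivProdArrow (Fin m) ι Bool).symm.sum_comp, Fintype.sum_prod_type]
    refine Finset.sum_congr rfl fun y _ => ?_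
    rw [hF]
    refine Finset.sum_congr rfl fun z _ => Finset.prod_congr rfl fun j _ => congrArg _ ?_
    funext i
    beta_reduce
    rcases σ j i with k | k
    · refine Fin.addCases (fun a => ?_) (fun a => ?_) k <;>
        simp [Equiv.sumArrowEquivProdArrow]
    · simp [Equiv.sumArrowEquivProdArrow]

theorem mem_ppsSet {S : Set (Fn ℝ≥0)} {n : ℕ} {F : FnOn ℝ≥0 n} (h : (⟨n, F⟩ : Fn ℝ≥0) ∈ S) :
    F ∈ ppsSet S n :=
  ppsRep_iff_exists_fintype.2 ⟨Empty, Unit, inferInstance, inferInstance, inferInstance,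
    fun _ => ⟨n, F⟩, fun _ i => .inl i, fun _ => h, fun x => by simp⟩

namespace IsFnClone

variable {K : ∀ n, Set (FnOn ℝ≥0 n)} (hK : IsFnClone K)
include hK

theorem prod {n : ℕ} {ι : Type*} (s : Finset ι) {F : ι → FnOn ℝ≥0 n} (hF : ∀ i, F i ∈ K n) :
    (fun x => ∏ i ∈ s, F i x) ∈ K n := by
  classical
  induction s using Finset.induction_on with
  | empty => simpa using hK.one n
  | insert a s ha ih =>
    simp only [Finset.prod_insert ha]
    exact hK.mul (hF a) ih

theorem ppsSet_subset {S : Set (Fn ℝ≥0)} (hS : ∀ G ∈ S, G.2 ∈ K G.1) (n : ℕ) :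
    ppsSet S n ⊆ K n := by
  rintro F ⟨m, s, G, σ, hG, hF⟩
  rw [funext hF]
  exact hK.sum (F := fun z => ∏ j, (G j).2 (fun i => z (σ j i)))
    (hK.prod _ fun j => hK.comp (σ j) (hS _ (hG j)))

theorem closure : IsFnClone (fun n => closure (K n)) where
  one n := subset_closure (hK.one n)
  mul hF hG := map_mem_closure₂ (f := fun F G x => F x * G x) (by fun_prop) hF hG
    fun _ ha _ hb => hK.mul ha hb
  comp σ hF := map_mem_closure (f := fun F x => F (x ∘ σ)) (by fun_prop) hF
    fun _ ha => hK.comp σ ha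
  sum {n m} _ hF := map_mem_closure (f := fun F x => ∑ y : Fin m → Bool, F (Fin.append x y))
    (by fun_prop) hF fun _ ha => hK.sum ha

theorem sum_of_split {n m : ℕ} {H : (Fin n → Bool) → (Fin m → Bool) → ℝ≥0}
    (h : (fun x : Fin (n + m) → Bool => H (x ∘ Fin.castAdd m) (x ∘ Fin.natAdd n)) ∈ K (n + m)) :
    (fun x => ∑ y, H x y) ∈ K n := by
  have := hK.sum h
  convert this using 5 with x y
  · funext i; simp
  · funext i; simp

theorem sum_bool {n : ℕ} {H : (Fin n → Bool) → Bool → ℝ≥0}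
    (h : (fun x : Fin (n + 1) → Bool => H (fun i => x i.castSucc) (x (Fin.last n))) ∈ K (n + 1)) :
    (fun x => ∑ b, H x b) ∈ K n := by
  have := hK.sum_of_split (m := 1) (H := fun x y => H x (y 0)) h
  convert this using 2 with x
  exact ((Equiv.funUnique (Fin 1) Bool).sum_comp fun b => H x b).symm

theorem unary {u : Bool → ℝ≥0} (h : (fun x : Fin 1 → Bool => u (x 0)) ∈ K 1) {n : ℕ} (i : Fin n) :
    (fun x => u (x i)) ∈ K n :=
  hK.comp (fun _ => i) h

theorem binary {M : Bool → Bool → ℝ≥0} (h : (fun x : Fin 2 → Bool => M (x 0) (x 1)) ∈ K 2) {n : ℕ}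
    (i j : Fin n) : (fun x => M (x i) (x j)) ∈ K n :=
  hK.comp ![i, j] h

theorem const (hU : K 1 = Set.univ) (c : ℝ≥0) (n : ℕ) : (fun _ => c) ∈ K n := by
  have h := hK.sum_bool (n := n) (H := fun _ b => bif b then c else 0)
    (hK.unary (u := fun b => bif b then c else 0) (by simp [hU]) _)
  simpa using h

end IsFnClone

theorem mem_cloneOmega_iff {𝓕 : Set (Fn ℝ≥0)} {n : ℕ} {F : FnOn ℝ≥0 n} :
    (⟨n, F⟩ : Fn ℝ≥0) ∈ CloneOmega ℝ≥0 𝓕 ↔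
      ∃ S : Set (Fn ℝ≥0), S ⊆ 𝓕 ∪ {EQfn ℝ≥0} ∧ S.Finite ∧ F ∈ closure (ppsSet S n) := by
  refine exists_congr fun S => and_congr_right fun _ => and_congr_right fun _ => ?_
  rw [Metric.mem_closure_iff]
  refine forall₂_congr fun ε hε => exists_congr fun G => and_congr_right fun _ => ?_
  rw [dist_comm, dist_pi_lt_iff hε]

/-- The `n`-ary members of the pps_ω-definable functional clone generated by `𝓕`. -/
def omegaSet (𝓕 : Set (Fn ℝ≥0)) (n : ℕ) : Set (FnOn ℝ≥0 n) :=
  {F | (⟨n, F⟩ : Fn ℝ≥0) ∈ CloneOmega ℝ≥0 𝓕}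

theorem mem_omegaSet {𝓕 : Set (Fn ℝ≥0)} {G : Fn ℝ≥0} (h : G ∈ 𝓕 ∪ {EQfn ℝ≥0}) :
    G.2 ∈ omegaSet 𝓕 G.1 :=
  mem_cloneOmega_iff.2 ⟨{G}, by simpa using h, Set.finite_singleton _,
    subset_closure (mem_ppsSet rfl)⟩

theorem closure_ppsSet_subset_omegaSet {𝓕 S : Set (Fn ℝ≥0)} (hS : S.Finite)
    (h : ∀ G ∈ S, G.2 ∈ omegaSet 𝓕 G.1) (n : ℕ) : closure (ppsSet S n) ⊆ omegaSet 𝓕 n := by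
  choose! T hT hTf hGT using fun G hG => mem_cloneOmega_iff.1 (h G hG)
  intro F hF
  refine mem_cloneOmega_iff.2 ⟨⋃ G ∈ S, T G, Set.iUnion₂_subset hT, hS.biUnion hTf, ?_⟩
  refine closure_minimal ?_ isClosed_closure hF
  refine (isFnClone_ppsSet _).closure.ppsSet_subset (fun G hG => ?_) n
  refine closure_mono ?_ (hGT G hG)
  exact fun H hH => PpsRep.mono (Set.subset_biUnion_of_mem hG) hH

theorem isFnClone_omegaSet (𝓕 : Set (Fn ℝ≥0)) : IsFnClone (omegaSet 𝓕) where
  one n := closure_ppsSet_subset_omegaSet Set.finite_empty (by simp) n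
    (subset_closure ((isFnClone_ppsSet _).one n))
  mul {n F G} hF hG := by
    refine closure_ppsSet_subset_omegaSet (S := {⟨n, F⟩, ⟨n, G⟩}) (by simp) ?_ n
      (subset_closure ((isFnClone_ppsSet _).mul (mem_ppsSet (by simp)) (mem_ppsSet (by simp))))
    rintro _ (rfl | rfl)
    exacts [hF, hG]
  comp {n m F} σ hF := by
    refine closure_ppsSet_subset_omegaSet (S := {⟨n, F⟩}) (by simp) ?_ m
      (subset_closure ((isFnClone_ppsSet _).comp σ (mem_ppsSet (by simp))))
    rintro _ rfl
    exact hF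
  sum {n m F} hF := by
    refine closure_ppsSet_subset_omegaSet (S := {⟨n + m, F⟩}) (by simp) ?_ n
      (subset_closure ((isFnClone_ppsSet _).sum (mem_ppsSet (by simp))))
    rintro _ rfl
    exact hF

/-- Closure under passing to the limit of the sequence `G ^ k * H`, for `G ≤ 1`. -/
def PowLimClosed (K : ∀ n, Set (FnOn ℝ≥0 n)) : Prop :=
  ∀ ⦃n⦄ ⦃G H : FnOn ℝ≥0 n⦄, G ∈ K n → H ∈ K n → (∀ x, G x ≤ 1) →
    (fun x => if G x = 1 then H x else 0) ∈ K n

theorem powLimClosed_omegaSet (𝓕 : Set (Fn ℝ≥0)) : PowLimClosed (omegaSet 𝓕) := by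
  intro n G H hG hH hle
  refine closure_ppsSet_subset_omegaSet (S := {⟨n, G⟩, ⟨n, H⟩}) (by simp) ?_ n ?_
  · rintro _ (rfl | rfl)
    exacts [hG, hH]
  · have hcl := isFnClone_ppsSet {(⟨n, G⟩ : Fn ℝ≥0), ⟨n, H⟩}
    refine mem_closure_of_tendsto (b := Filter.atTop) (f := fun (k : ℕ) x => G x ^ k * H x) ?_
      (Filter.Eventually.of_forall fun k => ?_)
    · rw [tendsto_pi_nhds]
      intro x
      by_cases h : G x = 1
      · simp [h]
      · simpa [h] using
          (NNReal.tendsto_pow_atTop_nhds_zero_of_lt_one ((hle x).lt_of_ne h)).mul_const (H x)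
    · refine hcl.mul ?_ (mem_ppsSet (by simp))
      simpa using hcl.prod (Finset.range k) (F := fun _ => G) fun _ => mem_ppsSet (by simp)

namespace IsFnClone

variable {K : ∀ n, Set (FnOn ℝ≥0 n)} (hK : IsFnClone K) (hU : K 1 = Set.univ)
include hK hU

theorem unary_mem (u : Bool → ℝ≥0) {n : ℕ} (i : Fin n) : (fun x => u (x i)) ∈ K n :=
  hK.unary (u := u) (by simp [hU]) i

theorem scale_binary {M : Bool → Bool → ℝ≥0} (hM : (fun x => M (x 0) (x 1)) ∈ K 2)
    (u v : Bool → ℝ≥0) : (fun x => M (x 0) (x 1) * (u (x 0) * v (x 1))) ∈ K 2 :=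
  hK.mul hM (hK.mul (hK.unary_mem hU u 0) (hK.unary_mem hU v 1))

theorem IMP_mem_of_lt_of_pos (hL : PowLimClosed K) {M : Bool → Bool → ℝ≥0}
    (hM : (fun x => M (x 0) (x 1)) ∈ K 2)
    (hlt : M false true * M true false < M false false * M true true)
    (hpos : 0 < M false true) : IMPfn.2 ∈ K 2 := by
  have had : 0 < M false false * M true true := bot_le.trans_lt hlt
  have ha : 0 < M false false := pos_of_mul_pos_left had zero_le
  have hd : 0 < M true true := pos_of_mul_pos_right had zero_le
  have hG := hK.scale_binary hU hM (fun b => bif b then M false true / M true true else 1)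
    (fun b => bif b then (M false true)⁻¹ else (M false false)⁻¹)
  have h10 : M true false * (M false true / M true true * (M false false)⁻¹) < 1 := by
    have : M true false * (M false true / M true true * (M false false)⁻¹) =
        M false true * M true false / (M false false * M true true) := by
      field_simp
    rw [this, div_lt_one had]
    exact hlt
  have h11 : M true true * (M false true / M true true * (M false true)⁻¹) = 1 := by field_simp
  have h00 : M false false * (1 * (M false false)⁻¹) = 1 := by field_simp
  have h01 : M false true * (1 * (M false true)⁻¹) = 1 := by field_simp
  have key := hL hG (hK.one 2) (by
    intro x
    cases x 0 <;> cases x 1 <;> simp only [cond_true, cond_false]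
    exacts [h00.le, h01.le, h10.le, h11.le])
  refine Set.mem_of_eq_of_mem (funext fun x : Fin 2 → Bool => ?_) key
  cases h0 : x 0 <;> cases h1 : x 1 <;>
    simp [IMPfn, h0, h1, h10.ne, h11, ha.ne', hpos.ne', -mul_eq_left₀]

theorem IMP_mem_of_lt (hL : PowLimClosed K) {M : Bool → Bool → ℝ≥0}
    (hM : (fun x => M (x 0) (x 1)) ∈ K 2)
    (hlt : M false true * M true false < M false false * M true true)
    (hne : ¬ (M false true = 0 ∧ M true false = 0)) : IMPfn.2 ∈ K 2 := by
  by_cases h : M false true = 0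
  · have h' : 0 < M true false := pos_iff_ne_zero.2 fun h' => hne ⟨h, h'⟩
    have := hK.IMP_mem_of_lt_of_pos hU hL (M := fun a b => M b a) (hK.binary hM 1 0)
      (by simpa only [mul_comm] using hlt) h'
    exact this
  · exact hK.IMP_mem_of_lt_of_pos hU hL hM hlt (pos_iff_ne_zero.2 h)

theorem NEQ_mem_of_lt (hL : PowLimClosed K) {M : Bool → Bool → ℝ≥0}
    (hM : (fun x => M (x 0) (x 1)) ∈ K 2)
    (hlt : M false false * M true true < M false true * M true false) : NEQfn.2 ∈ K 2 := by
  have hbc : 0 < M false true * M true false := bot_le.trans_lt hlt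
  have hb : 0 < M false true := pos_of_mul_pos_left hbc zero_le
  have hc : 0 < M true false := pos_of_mul_pos_right hbc zero_le
  obtain ⟨s, hs, has⟩ : ∃ s, M true true / (M false true * M true false) < s ∧
      M false false * s < 1 := by
    rcases eq_or_ne (M false false) 0 with h | h
    · exact ⟨_, lt_add_one _, by simp [h]⟩
    · have h' := pos_iff_ne_zero.2 h
      obtain ⟨s, hs, hs'⟩ := exists_between
        (show M true true / (M false true * M true false) < 1 / M false false by
          rw [div_lt_div_iff₀ hbc h', one_mul, mul_comm]
          exact hlt)
      rw [lt_div_iff₀ h', mul_comm] at hs'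
      exact ⟨s, hs, hs'⟩
  have hs0 : 0 < s := bot_le.trans_lt hs
  have hG := hK.scale_binary hU hM (fun b => bif b then (M true false * s)⁻¹ else 1)
    (fun b => bif b then (M false true)⁻¹ else s)
  have h11 : M true true * ((M true false * s)⁻¹ * (M false true)⁻¹) < 1 := by
    have : M true true * ((M true false * s)⁻¹ * (M false true)⁻¹) =
        M true true / (M false true * M true false) / s := by
      field_simp
    rw [this, div_lt_one hs0]
    exact hs
  have h10 : M true false * ((M true false * s)⁻¹ * s) = 1 := by field_simp
  have h00 : M false false * (1 * s) < 1 := by simpa using has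
  have h01 : M false true * (1 * (M false true)⁻¹) = 1 := by field_simp
  have key := hL hG (hK.one 2) (by
    intro x
    cases x 0 <;> cases x 1 <;> simp only [cond_true, cond_false]
    exacts [h00.le, h01.le, h10.le, h11.le])
  refine Set.mem_of_eq_of_mem (funext fun x : Fin 2 → Bool => ?_) key
  cases h0 : x 0 <;> cases h1 : x 1 <;>
    simp only [NEQfn, h0, h1, h00.ne, h01, h10, h11.ne, cond_true, cond_false, ne_eq,
      if_true, if_false, not_true_eq_false, reduceCtorEq, not_false_eq_true]

omit hU in
theorem negate_right (hN : NEQfn.2 ∈ K 2) {M : Bool → Bool → ℝ≥0}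
    (hM : (fun x => M (x 0) (x 1)) ∈ K 2) : (fun x => M (x 0) (!x 1)) ∈ K 2 := by
  have := hK.sum_bool (n := 2) (H := fun x b => M (x 0) b * if b ≠ x 1 then 1 else 0)
    (hK.mul (hK.binary hM _ _)
      (hK.binary (M := fun a b => if a ≠ b then 1 else 0) hN _ _))
  convert this using 2 with x
  cases x 1 <;> simp

theorem IMP_mem_of_ne (hL : PowLimClosed K) {M : Bool → Bool → ℝ≥0}
    (hM : (fun x => M (x 0) (x 1)) ∈ K 2)
    (h : M false false * M true true ≠ M false true * M true false)
    (had : ¬ (M false false = 0 ∧ M true true = 0))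
    (hbc : ¬ (M false true = 0 ∧ M true false = 0)) : IMPfn.2 ∈ K 2 := by
  rcases h.lt_or_gt with h | h
  · exact hK.IMP_mem_of_lt hU hL (M := fun a b => M a (!b))
      (hK.negate_right (hK.NEQ_mem_of_lt hU hL hM h) hM) h had
  · exact hK.IMP_mem_of_lt hU hL hM h hbc

theorem ite_eq_mem (hI : IMPfn.2 ∈ K 2) (hN : NEQfn.2 ∈ K 2) {n : ℕ} (a : Fin n → Bool)
    {c : ℝ≥0} (hc : 1 ≤ c) : (fun x => if x = a then c else 1) ∈ K n := by
  have hI' : (fun x : Fin 2 → Bool => if x 0 = true ∧ x 1 = false then (0 : ℝ≥0) else 1) ∈ K 2 :=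
    hI
  have hQ : ∀ b : Bool,
      (fun x : Fin 2 → Bool => if x 0 = true ∧ x 1 ≠ b then (0 : ℝ≥0) else 1) ∈ K 2
    | true => by simpa using hI'
    | false => by
      simpa using hK.negate_right (M := fun a b => if a = true ∧ b = false then 0 else 1) hN hI'
  have := hK.sum_bool (n := n)
    (H := fun x b => (bif b then c - 1 else 1) *
      ∏ i, if b = true ∧ x i ≠ a i then (0 : ℝ≥0) else 1)
    (hK.mul (hK.unary_mem hU (fun b => bif b then c - 1 else 1) _)
      (hK.prod _ fun i =>
        hK.binary (M := fun b d => if b = true ∧ d ≠ a i then (0 : ℝ≥0) else 1) (hQ (a i)) _ _))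
  convert this using 2 with x
  by_cases h : x = a
  · simp [h, tsub_add_cancel_of_le hc]
  · obtain ⟨i, hi⟩ := Function.ne_iff.1 h
    simp only [Fintype.sum_bool, cond_true, cond_false, true_and, h, if_false]
    rw [Finset.prod_eq_zero (Finset.mem_univ i) (by simp [hi])]
    simp

theorem mem_of_forall_pos (hI : IMPfn.2 ∈ K 2) (hN : NEQfn.2 ∈ K 2) {n : ℕ} {F : FnOn ℝ≥0 n}
    (hF : ∀ x, 0 < F x) : F ∈ K n := by
  obtain ⟨z, hz⟩ := Finite.exists_min F
  have := hK.mul (hK.const hU (F z) n) (hK.prod Finset.univ fun a =>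
    hK.ite_eq_mem hU hI hN a ((one_le_div (hF z)).2 (hz a)))
  convert this using 2 with x
  rw [Finset.prod_ite_eq]
  have := (hF z).ne'
  simp only [Finset.mem_univ, if_true]
  field_simp

theorem mem_of_IMP_of_NEQ (hL : PowLimClosed K) (hI : IMPfn.2 ∈ K 2) (hN : NEQfn.2 ∈ K 2) {n : ℕ}
    (F : FnOn ℝ≥0 n) : F ∈ K n := by
  have h := hL
    (hK.mem_of_forall_pos hU hI hN (F := fun x : Fin n → Bool => if F x = 0 then 2⁻¹ else 1)
      fun x => by split_ifs <;> simp)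
    (hK.mem_of_forall_pos hU hI hN (F := fun x : Fin n → Bool => if F x = 0 then 1 else F x)
      fun x => by split_ifs with h <;> simp [pos_iff_ne_zero, h])
    (fun x => by
      split_ifs
      · exact inv_le_one_of_one_le₀ one_le_two
      · exact le_rfl)
  convert h using 2 with x
  by_cases h : F x = 0 <;> simp [h]

end IsFnClone

/-- A `2 × 2` matrix that has rank at most one, or is diagonal, or is antidiagonal. -/
def IsDegenerate (M : Bool → Bool → ℝ≥0) : Prop :=
  M false false * M true true = M false true * M true false ∨
    (M false false = 0 ∧ M true true = 0) ∨ (M false true = 0 ∧ M true false = 0)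

section Product

variable {n : ℕ} (F : FnOn ℝ≥0 n)

/-- The marginal of `F`, weighted by the unary functions `u k`, on the variables `i` and `j`. -/
def marginal (u : Fin n → Bool → ℝ≥0) (i j : Fin n) (a b : Bool) : ℝ≥0 :=
  ∑ z, if z i = a ∧ z j = b then F z * ∏ k, u k (z k) else 0

/-- The marginal of `F`, weighted by the unary functions `u k`, on the variable `i`. -/
def marginalOne (u : Fin n → Bool → ℝ≥0) (i : Fin n) (a : Bool) : ℝ≥0 :=
  ∑ z, if z i = a then F z * ∏ k, u k (z k) else 0

variable {F}

theorem marginalOne_update (u : Fin n → Bool → ℝ≥0) (i j : Fin n) (a : Bool) (v : Bool → ℝ≥0) :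
    marginalOne F (Function.update u j v) i a =
      ∑ b, v b * marginal F (Function.update u j 1) i j a b := by
  simp only [marginalOne, marginal, Finset.mul_sum]
  rw [Finset.sum_comm]
  refine Finset.sum_congr rfl fun z _ => ?_
  have h : ∀ w : Bool → ℝ≥0, ∏ k, Function.update u j w k (z k) =
      w (z j) * ∏ k ∈ Finset.univ.erase j, u k (z k) := by
    intro w
    rw [← Finset.mul_prod_erase _ _ (Finset.mem_univ j), Function.update_self]
    congr 1
    refine Finset.prod_congr rfl fun k hk => ?_
    rw [Function.update_of_ne (Finset.ne_of_mem_erase hk)]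
  rw [h, h]
  by_cases hz : z i = a
  · cases hj : z j <;> simp [hz] <;> ring
  · simp [hz]

theorem eq_zero_of_marginal_eq_zero {u : Fin n → Bool → ℝ≥0} (hu : ∀ k b, 0 < u k b)
    {i j : Fin n} {a b : Bool} (h : marginal F u i j a b = 0) {z : Fin n → Bool} (hi : z i = a)
    (hj : z j = b) : F z = 0 := by
  have := Finset.sum_eq_zero_iff.1 h z (Finset.mem_univ z)
  simpa [hi, hj, Finset.prod_eq_zero_iff, (hu _ _).ne'] using this

theorem marginalOne_ne_zero {u : Fin n → Bool → ℝ≥0} (hu : ∀ k b, 0 < u k b) (i : Fin n)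
    {z : Fin n → Bool} (hz : F z ≠ 0) : marginalOne F u i (z i) ≠ 0 := by
  intro h
  have := Finset.sum_eq_zero_iff.1 h z (Finset.mem_univ z)
  simp [hz, Finset.prod_eq_zero_iff, (hu _ _).ne'] at this

theorem marginalOne_cross_of_pos
    (hF : ∀ u : Fin n → Bool → ℝ≥0, (∀ k b, 0 < u k b) → ∀ i j, i ≠ j →
      marginal F u i j false false * marginal F u i j true true =
        marginal F u i j false true * marginal F u i j true false)
    (hne : F ≠ 0) (i : Fin n) {u v : Fin n → Bool → ℝ≥0} (hu : ∀ k b, 0 < u k b)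
    (hv : ∀ k b, 0 < v k b) (huv : u i = v i) :
    marginalOne F u i false * marginalOne F v i true =
      marginalOne F u i true * marginalOne F v i false := by
  obtain ⟨z, hz⟩ := Function.ne_iff.1 hne
  have hpw : ∀ s : Finset (Fin n), ∀ k b, 0 < s.piecewise v u k b := fun s k b => by
    by_cases h : k ∈ s <;> simp [h, hu, hv]
  have hstep : ∀ (w : Fin n → Bool → ℝ≥0) (j : Fin n) (t : Bool → ℝ≥0), (∀ k b, 0 < w k b) →
      i ≠ j → marginalOne F w i false * marginalOne F (Function.update w j t) i true =
        marginalOne F w i true * marginalOne F (Function.update w j t) i false := by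
    intro w j t hw hij
    have hM := hF (Function.update w j 1) (fun k b => by
      by_cases h : k = j
      · subst h; simp
      · simp [h, hw]) i j hij
    have hself : ∀ a, marginalOne F w i a =
        ∑ b, w j b * marginal F (Function.update w j 1) i j a b := fun a => by
      rw [← marginalOne_update, Function.update_eq_self]
    rw [hself, hself, marginalOne_update, marginalOne_update]
    simp only [Fintype.sum_bool]
    rw [← NNReal.coe_inj] at hM ⊢
    push_cast at hM ⊢
    linear_combination ((w j false : ℝ) * t true - w j true * t false) * hM
  have key : ∀ s : Finset (Fin n), i ∉ s →
      marginalOne F u i false * marginalOne F (s.piecewise v u) i true =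
        marginalOne F u i true * marginalOne F (s.piecewise v u) i false := by
    intro s
    induction s using Finset.induction_on with
    | empty => intro _; simp [mul_comm]
    | insert j s hj ih =>
      intro hi
      rw [Finset.mem_insert, not_or] at hi
      have h1 := ih hi.2
      have h2 := hstep _ j (v j) (hpw s) hi.1
      rw [← Finset.piecewise_insert] at h2
      have h3 := marginalOne_ne_zero (hpw s) i hz
      cases hzi : z i <;> rw [hzi] at h3
      · refine mul_left_cancel₀ h3 ?_
        calc _ = marginalOne F u i false * (marginalOne F (s.piecewise v u) i false *
              marginalOne F ((insert j s).piecewise v u) i true) := by ring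
          _ = _ := by rw [h2, ← mul_assoc, h1]; ring
      · refine mul_left_cancel₀ h3 ?_
        calc _ = marginalOne F u i false * marginalOne F (s.piecewise v u) i true *
              marginalOne F ((insert j s).piecewise v u) i true := by ring
          _ = marginalOne F u i true * (marginalOne F (s.piecewise v u) i false *
              marginalOne F ((insert j s).piecewise v u) i true) := by rw [h1]; ring
          _ = _ := by rw [h2]; ring
  have := key (Finset.univ.erase i) (Finset.notMem_erase i _)
  have hpv : (Finset.univ.erase i).piecewise v u = v := by
    funext k
    by_cases h : k = i
    · subst h; simp [huv]
    · simp [h]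
  rwa [hpv] at this

theorem cross_eq
    (hF : ∀ u : Fin n → Bool → ℝ≥0, (∀ k b, 0 < u k b) → ∀ i j, i ≠ j →
      marginal F u i j false false * marginal F u i j true true =
        marginal F u i j false true * marginal F u i j true false)
    (i : Fin n) (y z : Fin n → Bool) :
    F (Function.update y i false) * F (Function.update z i true) =
      F (Function.update y i true) * F (Function.update z i false) := by
  by_cases hne : F = 0
  · simp [hne]
  let ω : ℝ≥0 → (Fin n → Bool) → Fin n → Bool → ℝ≥0 := fun ε y k b =>
    if k = i ∨ b = y k then 1 else ε
  have hω : ∀ ε, 0 < ε → ∀ y k b, 0 < ω ε y k b := fun ε hε y k b => by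
    simp only [ω]; split_ifs <;> simp [hε]
  have hzero : ∀ y a, marginalOne F (ω 0 y) i a = F (Function.update y i a) := by
    intro y a
    rw [marginalOne, Finset.sum_eq_single (Function.update y i a)]
    · rw [if_pos (by simp), Finset.prod_eq_one, mul_one]
      intro k _
      by_cases h : k = i <;> simp [ω, h]
    · intro x _ hx
      split_ifs with hxi
      · obtain ⟨k, hk⟩ := Function.ne_iff.1 hx
        have hki : k ≠ i := by
          rintro rfl
          simp [hxi] at hk
        rw [Function.update_of_ne hki] at hk
        rw [Finset.prod_eq_zero (Finset.mem_univ k) (by simp [ω, hki, hk]), mul_zero]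
      · rfl
    · simp
  have hcont : ∀ y a, Continuous fun ε => marginalOne F (ω ε y) i a := by
    intro y a
    refine continuous_finsetSum _ fun x _ => ?_
    split_ifs
    · refine continuous_const.mul (continuous_finsetProd _ fun k _ => ?_)
      simp only [ω]
      split_ifs <;> fun_prop
    · exact continuous_const
  have hcl : IsClosed {ε | marginalOne F (ω ε y) i false * marginalOne F (ω ε z) i true =
      marginalOne F (ω ε y) i true * marginalOne F (ω ε z) i false} :=
    isClosed_eq ((hcont _ _).mul (hcont _ _)) ((hcont _ _).mul (hcont _ _))
  have hmem : (0 : ℝ≥0) ∈ closure (Set.Ioi 0) := by simp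
  have := closure_minimal (fun ε hε => ?_) hcl hmem
  · simpa only [Set.mem_ofPred_eq, hzero] using this
  · exact marginalOne_cross_of_pos hF hne i (hω ε hε y) (hω ε hε z) (by simp [ω])

theorem eq_prod_of_cross
    (hF : ∀ i y z, F (Function.update y i false) * F (Function.update z i true) =
      F (Function.update y i true) * F (Function.update z i false))
    {z : Fin n → Bool} (hz : F z ≠ 0) (x : Fin n → Bool) :
    F x = F z * ∏ k, F (Function.update z k (x k)) / F z := by
  have hF' : ∀ i y b, y i = z i →
      F (Function.update y i b) * F z = F y * F (Function.update z i b) := by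
    intro i y b hyz
    have h := hF i y z
    have hy := Function.update_eq_self i y
    have hzz := Function.update_eq_self i z
    cases hzi : z i <;> rw [hyz, hzi] at hy <;> rw [hzi] at hzz <;>
      rw [hy, hzz] at h <;> cases b <;> simp only [hy, hzz, h]
  have key : ∀ s : Finset (Fin n),
      F (s.piecewise x z) = F z * ∏ k ∈ s, F (Function.update z k (x k)) / F z := by
    intro s
    induction s using Finset.induction_on with
    | empty => simp
    | insert i s hi ih =>
      rw [Finset.piecewise_insert, Finset.prod_insert hi, mul_left_comm, ← ih, div_mul_eq_mul_div,
        eq_div_iff hz, hF' _ _ _ (by simp [hi]), mul_comm]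
  simpa using key Finset.univ

end Product

namespace IsFnClone

variable {K : ∀ n, Set (FnOn ℝ≥0 n)} (hK : IsFnClone K) (hU : K 1 = Set.univ)
include hK hU

theorem marginal_mem (hE : (EQfn ℝ≥0).2 ∈ K 2) {n : ℕ} {F : FnOn ℝ≥0 n} (hF : F ∈ K n)
    (u : Fin n → Bool → ℝ≥0) (i j : Fin n) :
    (fun x => marginal F u i j (x 0) (x 1)) ∈ K 2 := by
  have hE' : ∀ a b, (fun x : Fin (2 + n) → Bool => if x a = x b then (1 : ℝ≥0) else 0) ∈ K (2 + n) :=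
    fun a b => hK.binary (M := fun a b => if a = b then (1 : ℝ≥0) else 0) hE a b
  have := hK.sum_of_split (n := 2) (m := n)
    (H := fun x z => ((if z i = x 0 then 1 else 0) * if z j = x 1 then 1 else 0) *
      (F z * ∏ k, u k (z k)))
    (hK.mul (hK.mul (hE' _ _) (hE' _ _)) (hK.mul (hK.comp (Fin.natAdd 2) hF)
      (hK.prod _ fun k => hK.unary_mem hU (u k) (Fin.natAdd 2 k))))
  convert this using 2 with x
  refine Finset.sum_congr rfl fun z _ => ?_
  by_cases h : z i = x 0 <;> by_cases h' : z j = x 1 <;> simp [h, h']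

omit hU in
theorem sum_update_mem {n : ℕ} {F : FnOn ℝ≥0 n} (hF : F ∈ K n) (j : Fin n) :
    (fun x => ∑ b, F (Function.update x j b)) ∈ K n := by
  refine hK.sum_bool (H := fun x b => F (Function.update x j b)) ?_
  have := hK.comp (Function.update Fin.castSucc j (Fin.last n)) hF
  convert this using 3 with x
  funext k
  by_cases h : k = j
  · subst h; simp
  · simp [h]

/-- If all binary functions of a clone are degenerate, then all of its members belong to any clone
that contains all unary functions, equality and disequality. -/
theorem mem_of_forall_isDegenerate (hE : (EQfn ℝ≥0).2 ∈ K 2)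
    (hdeg : ∀ M : Bool → Bool → ℝ≥0, (fun x => M (x 0) (x 1)) ∈ K 2 → IsDegenerate M)
    {L : ∀ n, Set (FnOn ℝ≥0 n)} (hL : IsFnClone L) (hLU : L 1 = Set.univ)
    (hLE : (EQfn ℝ≥0).2 ∈ L 2) (hLN : NEQfn.2 ∈ L 2) {n : ℕ} {F : FnOn ℝ≥0 n} (hF : F ∈ K n) :
    F ∈ L n := by
  suffices ∀ T : Finset (Fin n), ∀ F ∈ K n, DependsOn F (T : Set (Fin n)) → F ∈ L n from
    this Finset.univ F hF fun x y h => by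
      rw [show x = y from funext fun i => h i (by simp)]
  clear! F
  intro T
  induction T using Finset.strongInduction with
  | H T ih =>
  intro F hF hT
  by_cases h0 : F = 0
  · subst h0
    exact hL.const hLU 0 n
  obtain ⟨z, hz⟩ := Function.ne_iff.1 h0
  have hrel : ∀ e : Bool, (fun x : Fin 2 → Bool => if x 1 = xor (x 0) e then (1 : ℝ≥0) else 0) ∈ L 2
    | false => by
      have := hL.binary (n := 2) (M := fun a b => if a = b then (1 : ℝ≥0) else 0) hLE 1 0
      simpa using this
    | true => by
      have h := hL.binary (n := 2) (M := fun a b => if a ≠ b then (1 : ℝ≥0) else 0) hLN 1 0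
      convert h using 2 with x
      cases x 0 <;> cases x 1 <;> simp
  have hreduce : ∀ (i j : Fin n) (e : Bool), i ≠ j → (∀ x, F x ≠ 0 → x j = xor (x i) e) →
      F ∈ L n := by
    intro i j e hij hx
    by_cases hj : j ∈ T
    · have hF' := ih (T.erase j) (Finset.erase_ssubset hj) _ (hK.sum_update_mem hF j) (by
        intro x y hxy
        refine Finset.sum_congr rfl fun b _ => hT fun k hk => ?_
        by_cases h : k = j
        · subst h; simp
        · simp only [ne_eq, h, not_false_eq_true, Function.update_of_ne]
          exact hxy k (by simpa [h] using hk))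
      have := hL.mul hF' (hL.binary (M := fun a b => if b = xor a e then (1 : ℝ≥0) else 0)
        (hrel e) i j)
      convert this using 2 with x
      split_ifs with h
      · rw [mul_one, Finset.sum_eq_single (x j), Function.update_eq_self]
        · intro b _ hb
          by_contra hne
          have := hx _ hne
          rw [Function.update_self, Function.update_of_ne hij, ← h] at this
          exact hb this
        · simp
      · rw [mul_zero]
        by_contra hne
        exact h (hx x hne)
    · exfalso
      have h1 := hx z hz
      have h2 : F (Function.update z j (!z j)) = F z := hT fun k hk => by
        rw [Function.update_of_ne]
        rintro rfl
        exact hj hk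
      have h3 := hx (Function.update z j (!z j)) (by rwa [h2])
      rw [Function.update_self, Function.update_of_ne hij, ← h1] at h3
      simp at h3
  by_cases hrank : ∀ u : Fin n → Bool → ℝ≥0, (∀ k b, 0 < u k b) → ∀ i j, i ≠ j →
      marginal F u i j false false * marginal F u i j true true =
        marginal F u i j false true * marginal F u i j true false
  · have hprod := eq_prod_of_cross (cross_eq hrank) hz
    rw [show F = fun x => F z * ∏ k, F (Function.update z k (x k)) / F z from funext hprod]
    exact hL.mul (hL.const hLU _ n)
      (hL.prod _ fun k => hL.unary_mem hLU (fun b => F (Function.update z k b) / F z) k)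
  · push Not at hrank
    obtain ⟨u, hu, i, j, hij, hne⟩ := hrank
    rcases hdeg _ (hK.marginal_mem hU hE hF u i j) with h | ⟨h, h'⟩ | ⟨h, h'⟩
    · exact absurd h hne
    · refine hreduce i j true hij fun x hx => ?_
      cases hi : x i <;> cases hj : x j <;> simp
      · exact hx (eq_zero_of_marginal_eq_zero hu h hi hj)
      · exact hx (eq_zero_of_marginal_eq_zero hu h' hi hj)
    · refine hreduce i j false hij fun x hx => ?_
      cases hi : x i <;> cases hj : x j <;> simp
      · exact hx (eq_zero_of_marginal_eq_zero hu h hi hj)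
      · exact hx (eq_zero_of_marginal_eq_zero hu h' hi hj)

/-- A function that is not log-supermodular yields, after identifying and pinning variables, a
binary function that is not log-supermodular. -/
theorem exists_lt_of_not_isLSM {n : ℕ} {F : FnOn ℝ≥0 n} (hF : F ∈ K n)
    (hlsm : ¬ IsLSM F) : ∃ M : Bool → Bool → ℝ≥0, (fun x => M (x 0) (x 1)) ∈ K 2 ∧
      M false false * M true true < M false true * M true false := by
  unfold IsLSM at hlsm
  push Not at hlsm
  obtain ⟨x, y, hxy⟩ := hlsm
  let c : Bool → Bool → Bool → Bool → Bool := fun p q s t =>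
    if p = q then p else if p = true then s else t
  refine ⟨fun s t => F fun k => c (x k) (y k) s t, ?_, ?_⟩
  · have h0 : (fun w : Fin (2 + 2) → Bool => (if w 3 = true then (1 : ℝ≥0) else 0) *
        ((if w 2 = false then 1 else 0) *
        F (w ∘ fun k => if x k = y k then (if x k = true then 3 else 2) else
          if x k = true then 0 else 1))) ∈ K (2 + 2) :=
      hK.mul (hK.unary_mem hU (fun b => if b = true then 1 else 0) 3)
        (hK.mul (hK.unary_mem hU (fun b => if b = false then 1 else 0) 2) (hK.comp _ hF))
    have := hK.sum h0
    convert this using 2 with v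
    rw [Finset.sum_eq_single ![false, true]]
    · have h3 : Fin.append v ![false, true] 3 = true := rfl
      have h2 : Fin.append v ![false, true] 2 = false := rfl
      have h1 : Fin.append v ![false, true] 1 = v 1 := rfl
      have h0 : Fin.append v ![false, true] 0 = v 0 := rfl
      rw [h3, h2]
      simp only [if_true, one_mul]
      congr 1
      funext k
      simp only [Function.comp, c]
      split_ifs with h h' h'
      · rw [h3, h']
      · rw [h2]; simpa using h'
      · rw [h0]
      · rw [h1]
    · intro b _ hb
      have h3 : Fin.append v b 3 = b 1 := rfl
      have h2 : Fin.append v b 2 = b 0 := rfl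
      rw [h3, h2]
      cases hb0 : b 0 <;> cases hb1 : b 1 <;> simp
      exact absurd (by funext i; fin_cases i <;> simp [hb0, hb1]) hb
    · simp
  · have e1 : (fun k => c (x k) (y k) true false) = x := by
      funext k; cases x k <;> cases y k <;> simp [c]
    have e2 : (fun k => c (x k) (y k) false true) = y := by
      funext k; cases x k <;> cases y k <;> simp [c]
    have e3 : (fun k => c (x k) (y k) true true) = x ⊔ y := by
      funext k; cases hx : x k <;> cases hy : y k <;> simp [c, hx, hy]
    have e4 : (fun k => c (x k) (y k) false false) = x ⊓ y := by
      funext k; cases hx : x k <;> cases hy : y k <;> simp [c, hx, hy]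
    beta_reduce
    rw [e1, e2, e3, e4, mul_comm, mul_comm (F y)]
    exact hxy

end IsFnClone

/-- Main theorem: if `F ∉ ⟨NEQ, ℬ₁⟩` then `IMP ∈ ⟨F, ℬ₁⟩_ω` and hence
`⟨IMP, ℬ₁⟩_ω ⊆ ⟨F, ℬ₁⟩_ω`; if in addition `F` is not log-supermodular, then
`⟨F, ℬ₁⟩_ω` is all of `ℬ`. -/
theorem main_theorem (n : ℕ) (F : FnOn ℝ≥0 n)
    (hF : (⟨n, F⟩ : Fn ℝ≥0) ∉ Clone ℝ≥0 ({NEQfn} ∪ unaryFns)) :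
    (IMPfn ∈ CloneOmega ℝ≥0 ({⟨n, F⟩} ∪ unaryFns) ∧
      CloneOmega ℝ≥0 ({IMPfn} ∪ unaryFns) ⊆ CloneOmega ℝ≥0 ({⟨n, F⟩} ∪ unaryFns)) ∧
    (¬ IsLSM F → CloneOmega ℝ≥0 ({⟨n, F⟩} ∪ unaryFns) = Set.univ) := by
  have hK := isFnClone_omegaSet ({⟨n, F⟩} ∪ unaryFns)
  have hlim := powLimClosed_omegaSet ({⟨n, F⟩} ∪ unaryFns)
  have hFK : F ∈ omegaSet ({⟨n, F⟩} ∪ unaryFns) n := mem_omegaSet (G := ⟨n, F⟩) (.inl (.inl rfl))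
  have hE : (EQfn ℝ≥0).2 ∈ omegaSet ({⟨n, F⟩} ∪ unaryFns) 2 := mem_omegaSet (.inr rfl)
  have hU : omegaSet ({⟨n, F⟩} ∪ unaryFns) 1 = Set.univ :=
    Set.eq_univ_of_forall fun u => mem_omegaSet (G := ⟨1, u⟩) (.inl (.inr rfl))
  have hI : IMPfn.2 ∈ omegaSet ({⟨n, F⟩} ∪ unaryFns) 2 := by
    by_contra hI
    refine hF (hK.mem_of_forall_isDegenerate hU hE (fun M hM => ?_)
      (isFnClone_ppsSet ({NEQfn} ∪ unaryFns ∪ {EQfn ℝ≥0}))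
      (Set.eq_univ_of_forall fun u => mem_ppsSet (F := u) (.inl (.inr rfl)))
      (mem_ppsSet (.inr rfl)) (mem_ppsSet (.inl (.inl rfl))) hFK)
    by_contra h
    simp only [IsDegenerate, not_or] at h
    exact hI (hK.IMP_mem_of_ne hU hlim hM h.1 h.2.1 h.2.2)
  refine ⟨⟨hI, ?_⟩, fun hlsm => Set.eq_univ_of_forall fun G => ?_⟩
  · rintro ⟨m, G⟩ hG
    obtain ⟨S, hS, hfin, hGS⟩ := mem_cloneOmega_iff.1 hG
    refine closure_ppsSet_subset_omegaSet hfin (fun H hH => ?_) m hGS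
    rcases hS hH with (rfl | h) | rfl
    exacts [hI, mem_omegaSet (.inl (.inr h)), hE]
  · obtain ⟨M, hM, hlt⟩ := hK.exists_lt_of_not_isLSM hU hFK hlsm
    exact hK.mem_of_IMP_of_NEQ hU hlim hI (hK.NEQ_mem_of_lt hU hlim hM hlt) G.2
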